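/- Let w be a C∞-word. Then every simple extension of w has the same height and the same root as w; in particular, the maximal extension of w has the same height and the same root as w. -/

import Mathlib

/- Common framework: words over the alphabet Σ = {1,2} (represented as natural
numbers), run-length encoding, the derivative D, k-differentiable words C^k,
C∞-words, heights, roots, primitives, minimal/maximal words, simple extensions,
minimal forbidden words, and the left frontier Ψ. -/

namespace CinftyWords

/-- A word is a finite sequence of natural numbers. -/
abbrev Word := List ℕ

/-- `w` is a word over the alphabet Σ = {1,2}. -/
def IsWord (w : Word) : Prop := ∀ x ∈ w, x = 1 ∨ x = 2

/-- Complement of a letter: exchanges 1 and 2. -/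
def bar (x : ℕ) : ℕ := 3 - x

/-- Letterwise complement of a word. -/
def comp (w : Word) : Word := w.map bar

/-- Run-length encoding Δ: the sequence of lengths of maximal runs of equal
consecutive letters. -/
def rle (w : Word) : Word := (w.splitBy (· == ·)).map List.length

/-- Drop the first run if it has length 1. -/
def dropFirstRun1 (g : List (List ℕ)) : List (List ℕ) :=
  match g with
  | [] => []
  | r :: rs => if r.length = 1 then rs else r :: rs

/-- The derivative `D w`: the run-length encoding of the word obtained from `w`
by deleting its first and/or last run when that run has length 1. -/
def D (w : Word) : Word :=
  ((dropFirstRun1 ((dropFirstRun1 (w.splitBy (· == ·))).reverse)).reverse).map List.length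

/-- `w` is differentiable: `w` is a word over Σ and so is its run-length encoding. -/
def Diffble (w : Word) : Prop := IsWord w ∧ IsWord (rle w)

/-- The set C^k of k-differentiable words: `D^[j] w` is differentiable for all `j < k`
(so that `D^[k] w` is defined). -/
def CK (k : ℕ) : Set Word := {w | IsWord w ∧ ∀ j < k, Diffble (D^[j] w)}

/-- The set C∞ of words differentiable arbitrarily many times. -/
def Cinf : Set Word := {w | ∀ k : ℕ, w ∈ CK k}

/-- The height of a C∞-word: the least `k` with `D^[k] w = []`. -/
noncomputable def height (w : Word) : ℕ := sInf {k | D^[k] w = []}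

/-- The root of a C∞-word: `D^[height w - 1] w`. -/
noncomputable def root (w : Word) : Word := D^[height w - 1] w

/-- `v` is a primitive of `w`: `v` is differentiable and `D v = w`. -/
def IsPrimitive (v w : Word) : Prop := Diffble v ∧ D v = w

/-- A nonempty C∞-word is maximal if each `D^[j] w` (for `j ≤ height w - 2`) is a
primitive of `D^[j+1] w` of maximal length (vacuously true when `height w = 1`). -/
def MaximalWord (w : Word) : Prop :=
  w ∈ Cinf ∧ w ≠ [] ∧ ∀ j, j + 2 ≤ height w →
    ∀ v, IsPrimitive v (D^[j + 1] w) → v.length ≤ (D^[j] w).length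

/-- A nonempty C∞-word is minimal if each `D^[j] w` (for `j ≤ height w - 2`) is a
primitive of `D^[j+1] w` of minimal length (vacuously true when `height w = 1`). -/
def MinimalWord (w : Word) : Prop :=
  w ∈ Cinf ∧ w ≠ [] ∧ ∀ j, j + 2 ≤ height w →
    ∀ v, IsPrimitive v (D^[j + 1] w) → (D^[j] w).length ≤ v.length

/-- `w` is right maximal: a suffix of a maximal word. -/
def RightMaximal (w : Word) : Prop := ∃ v, MaximalWord v ∧ w <:+ v

/-- `w` is left maximal: a prefix of a maximal word. -/
def LeftMaximal (w : Word) : Prop := ∃ v, MaximalWord v ∧ w <+: v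

/-- `w` is right minimal: a suffix of a minimal word. -/
def RightMinimal (w : Word) : Prop := ∃ v, MinimalWord v ∧ w <:+ v

/-- `w` is left minimal: a prefix of a minimal word. -/
def LeftMinimal (w : Word) : Prop := ∃ v, MinimalWord v ∧ w <+: v

/-- `w` is right doubly extendable: both `w1` and `w2` are C∞-words. -/
def RightDoublyExt (w : Word) : Prop := w ++ [1] ∈ Cinf ∧ w ++ [2] ∈ Cinf

/-- `w` is left doubly extendable: both `1w` and `2w` are C∞-words. -/
def LeftDoublyExt (w : Word) : Prop := 1 :: w ∈ Cinf ∧ 2 :: w ∈ Cinf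

/-- `w` is fully extendable: `1w1`, `1w2`, `2w1`, `2w2` are all C∞-words. -/
def FullyExt (w : Word) : Prop :=
  ∀ x, (x = 1 ∨ x = 2) → ∀ y, (y = 1 ∨ y = 2) → x :: (w ++ [y]) ∈ Cinf

/-- `w'` is a right simple extension of `w`: `w' = w ++ s` is a C∞-word and at each
step the extension by the complementary letter is not a C∞-word. -/
def RightSimpleExt (w w' : Word) : Prop :=
  w' ∈ Cinf ∧ ∃ s : Word, IsWord s ∧ w' = w ++ s ∧
    ∀ i < s.length, w ++ s.take i ++ [bar (s.getD i 0)] ∉ Cinf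

/-- `w'` is a left simple extension of `w`. -/
def LeftSimpleExt (w w' : Word) : Prop := RightSimpleExt w.reverse w'.reverse

/-- `w'` is a simple extension of `w`: a right simple extension of a left simple
extension of `w`. -/
def SimpleExt (w w' : Word) : Prop := ∃ v, LeftSimpleExt w v ∧ RightSimpleExt v w'

/-- `m` is the maximal extension of `w`: a simple extension of `w` of maximal length. -/
def IsMaximalExtension (w m : Word) : Prop :=
  SimpleExt w m ∧ ∀ v, SimpleExt w v → v.length ≤ m.length

/-- A language is factorial if it is closed under taking factors. -/
def Factorial (F : Set Word) : Prop := ∀ v ∈ F, ∀ u, u <:+: v → u ∈ F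

/-- A language is anti-factorial if no word of it is a proper factor of another
word of it. -/
def AntiFactorial (M : Set Word) : Prop := ∀ u ∈ M, ∀ v ∈ M, u ≠ v → ¬ u <:+: v

/-- The set of minimal forbidden words of a (factorial) language `F`: words not
in `F` whose maximal proper prefix and maximal proper suffix are both in `F`. -/
def MF (F : Set Word) : Set Word := {v | v ∉ F ∧ v.dropLast ∈ F ∧ v.tail ∈ F}

/-- The height of a minimal forbidden word of C∞: `k + 1`, where `k` is the
(unique) integer such that `w` is k-differentiable and `D^[k] w ∈ {111, 222}`. -/
noncomputable def MFheight (w : Word) : ℕ :=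
  sInf {k | w ∈ CK k ∧ (D^[k] w = [1, 1, 1] ∨ D^[k] w = [2, 2, 2])} + 1

/-- The left frontier Ψ of a C∞-word: the word of length `height w` over {0,1,2}
recording the first letter of each derivative, with `2` replaced by `0` when the
first two letters of the previous derivative are distinct. -/
noncomputable def psi (w : Word) : List ℕ :=
  (List.range (height w)).map (fun i =>
    if i = 0 then w.getD 0 0
    else if (D^[i] w).getD 0 0 = 2 ∧ (D^[i - 1] w).getD 0 0 ≠ (D^[i - 1] w).getD 1 0 then 0
    else (D^[i] w).getD 0 0)

end CinftyWords

namespace CinftyWords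

theorem isWord_append {u v : Word} : IsWord (u ++ v) ↔ IsWord u ∧ IsWord v :=
  List.forall_mem_append

theorem isWord_singleton {x : ℕ} : IsWord [x] ↔ x = 1 ∨ x = 2 := by
  simp [IsWord]

theorem isWord_bar {x : ℕ} (hx : x = 1 ∨ x = 2) : bar x = 1 ∨ bar x = 2 := by
  unfold bar; omega

/-! ### Runs -/

theorem exists_eq_append_replicate {w : Word} (hw : w ≠ []) :
    ∃ u k a, w = u ++ List.replicate (k + 1) a ∧ ∀ x ∈ u.getLast?, x ≠ a := by
  induction w using List.reverseRecOn with
  | nil => exact absurd rfl hw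
  | append_singleton w b ih =>
    rcases eq_or_ne w [] with rfl | hne
    · exact ⟨[], 0, b, by simp⟩
    · obtain ⟨u, k, a, rfl, hu⟩ := ih hne
      by_cases hab : a = b
      · subst hab
        exact ⟨u, k + 1, a, by rw [List.replicate_succ' (n := k + 1), List.append_assoc], hu⟩
      · refine ⟨u ++ List.replicate (k + 1) a, 0, b, by simp, ?_⟩
        simpa [List.replicate_succ', ← List.append_assoc] using hab

theorem splitBy_append_replicate {u : Word} {k a : ℕ} (hu : ∀ x ∈ u.getLast?, x ≠ a) :
    (u ++ List.replicate (k + 1) a).splitBy (· == ·) =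
      u.splitBy (· == ·) ++ [List.replicate (k + 1) a] := by
  rw [List.replicate_succ, List.splitBy_append_cons _ (by simpa using hu),
    ← List.replicate_succ, List.splitBy_of_isChain (l := List.replicate (k + 1) a) (by simp)]
  exact List.isChain_replicate_of_rel _ (by simp)

theorem rle_append_replicate {u : Word} {k a : ℕ} (hu : ∀ x ∈ u.getLast?, x ≠ a) :
    rle (u ++ List.replicate (k + 1) a) = rle u ++ [k + 1] := by
  simp [rle, splitBy_append_replicate hu]

theorem splitBy_reverse (w : Word) :
    w.reverse.splitBy (· == ·) = ((w.splitBy (· == ·)).map List.reverse).reverse := by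
  obtain ⟨h₁, h₂, h₃, h₄⟩ :=
    (List.splitBy_eq_iff (r := fun x y : ℕ => x == y) (m := w)).1 rfl
  rw [List.splitBy_eq_iff]
  refine ⟨?_, by simp, ?_, ?_⟩
  · rw [← List.reverse_flatten, List.flatten_splitBy]
  · simp only [List.mem_reverse, List.mem_map, forall_exists_index, and_imp,
      forall_apply_eq_imp_iff₂, List.isChain_reverse]
    intro m hm
    exact (h₃ m hm).imp fun a b hab => by simpa using (beq_iff_eq.1 hab).symm
  · rw [List.isChain_reverse, List.isChain_map]
    refine h₄.imp ?_
    rintro a b ⟨ha, hb, hab⟩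
    refine ⟨by simpa using hb, by simpa using ha, ?_⟩
    rwa [List.getLast_reverse, List.head_reverse, BEq.comm]

/-! ### Left trimming and the derivative -/

/-- The run-length encoding of `w` without its first run if that run has length 1. -/
def leftD (w : Word) : Word := (dropFirstRun1 (w.splitBy (· == ·))).map List.length

theorem dropFirstRun1_append {g : List (List ℕ)} (hg : g ≠ []) (h : List (List ℕ)) :
    dropFirstRun1 (g ++ h) = dropFirstRun1 g ++ h := by
  cases g with
  | nil => exact absurd rfl hg
  | cons r rs => simp only [dropFirstRun1, List.cons_append]; split <;> rfl

theorem dropFirstRun1_sublist (g : List (List ℕ)) : (dropFirstRun1 g).Sublist g := by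
  cases g with
  | nil => exact List.Sublist.refl _
  | cons r rs =>
    simp only [dropFirstRun1]
    split
    · exact List.sublist_cons_self _ _
    · exact List.Sublist.refl _

theorem dropFirstRun1_comm (g : List (List ℕ)) :
    (dropFirstRun1 (dropFirstRun1 g).reverse).reverse =
      dropFirstRun1 (dropFirstRun1 g.reverse).reverse := by
  rcases g with _ | ⟨r, rs⟩
  · rfl
  induction rs using List.reverseRecOn with
  | nil => by_cases h : r.length = 1 <;> simp [dropFirstRun1, h]
  | append_singleton rs s _ =>
    by_cases h : r.length = 1 <;> by_cases h' : s.length = 1 <;> simp [dropFirstRun1, h, h']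

theorem dropFirstRun1_map_reverse (g : List (List ℕ)) :
    dropFirstRun1 (g.map List.reverse) = (dropFirstRun1 g).map List.reverse := by
  cases g with
  | nil => rfl
  | cons r rs => by_cases h : r.length = 1 <;> simp [dropFirstRun1, h]

theorem D_reverse (w : Word) : D w.reverse = (D w).reverse := by
  unfold D
  rw [splitBy_reverse, ← List.map_reverse, dropFirstRun1_map_reverse, ← List.map_reverse,
    dropFirstRun1_map_reverse, ← dropFirstRun1_comm]
  simp [Function.comp_def, dropFirstRun1_comm]

theorem leftD_append_replicate {u : Word} {k a : ℕ} (hu : ∀ x ∈ u.getLast?, x ≠ a)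
    (h : u ≠ [] ∨ k ≠ 0) :
    leftD (u ++ List.replicate (k + 1) a) = leftD u ++ [k + 1] := by
  rw [leftD, splitBy_append_replicate hu]
  rcases eq_or_ne u [] with rfl | hne
  · simp [leftD, dropFirstRun1, h.resolve_left (by simp)]
  · simp [dropFirstRun1_append (List.splitBy_ne_nil.2 hne), leftD]

theorem D_append_replicate {u : Word} {k a : ℕ} (hu : ∀ x ∈ u.getLast?, x ≠ a) :
    D (u ++ List.replicate (k + 1) a) = leftD u ++ if k = 0 then [] else [k + 1] := by
  rw [D, splitBy_append_replicate hu]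
  rcases eq_or_ne u [] with rfl | hne
  · by_cases h : k = 0 <;> simp [leftD, dropFirstRun1, h]
  · rw [dropFirstRun1_append (List.splitBy_ne_nil.2 hne)]
    by_cases h : k = 0 <;> simp [leftD, dropFirstRun1, h]

theorem D_nil : D [] = [] := rfl

theorem D_singleton (a : ℕ) : D [a] = [] := by
  simpa [leftD, dropFirstRun1] using D_append_replicate (u := []) (k := 0) (a := a) (by simp)

theorem length_splitBy_le (w : Word) : (w.splitBy (· == ·)).length ≤ w.length := by
  by_cases hw : w = []
  · simp [hw]
  obtain ⟨u, k, a, rfl, hu⟩ := exists_eq_append_replicate hw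
  have := length_splitBy_le u
  rw [splitBy_append_replicate hu]
  simp only [List.length_append, List.length_singleton, List.length_replicate]
  omega
termination_by w.length
decreasing_by simp_all

theorem length_D_lt {w : Word} (hw : w ≠ []) : (D w).length < w.length := by
  obtain ⟨u, k, a, rfl, hu⟩ := exists_eq_append_replicate hw
  have h₁ := (dropFirstRun1_sublist (u.splitBy (· == ·))).length_le
  have h₂ := length_splitBy_le u
  rw [D_append_replicate hu]
  by_cases h : k = 0 <;>
    simp only [leftD, h, if_true, if_false, List.length_append, List.length_map,
      List.length_replicate, List.length_nil, List.length_singleton] <;> omega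

/-! ### C∞-words -/

theorem diffble_nil : Diffble [] := by simp [Diffble, IsWord, rle]

theorem mem_Cinf_iff {w : Word} : w ∈ Cinf ↔ ∀ j, Diffble (D^[j] w) :=
  ⟨fun h j => (h (j + 1)).2 j j.lt_succ_self, fun h _ => ⟨(h 0).1, fun j _ => h j⟩⟩

theorem mem_Cinf_iff_D {w : Word} : w ∈ Cinf ↔ Diffble w ∧ D w ∈ Cinf := by
  simp only [mem_Cinf_iff, ← Function.iterate_succ_apply]
  exact ⟨fun h => ⟨h 0, fun j => h (j + 1)⟩, fun h j => j.casesOn h.1 h.2⟩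

theorem iterate_D_nil (j : ℕ) : D^[j] [] = [] := Function.iterate_fixed D_nil j

theorem nil_mem_Cinf : [] ∈ Cinf :=
  mem_Cinf_iff.2 fun j => by rw [iterate_D_nil]; exact diffble_nil

theorem diffble_append_replicate {u : Word} {k a : ℕ} (hu : ∀ x ∈ u.getLast?, x ≠ a) :
    Diffble (u ++ List.replicate (k + 1) a) ↔ Diffble u ∧ (a = 1 ∨ a = 2) ∧ k ≤ 1 := by
  rw [Diffble, rle_append_replicate hu, isWord_append, isWord_append, isWord_singleton, Diffble]
  have h : IsWord (List.replicate (k + 1) a) ↔ a = 1 ∨ a = 2 := by simp [IsWord]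
  rw [h]
  have h' : k + 1 = 1 ∨ k + 1 = 2 ↔ k ≤ 1 := by omega
  rw [h']
  tauto

theorem singleton_mem_Cinf {x : ℕ} (hx : x = 1 ∨ x = 2) : [x] ∈ Cinf := by
  refine mem_Cinf_iff_D.2 ⟨?_, by rw [D_singleton]; exact nil_mem_Cinf⟩
  simpa using (diffble_append_replicate (u := []) (k := 0) (a := x) (by simp)).2
    ⟨diffble_nil, hx, by omega⟩

theorem append_singleton_of_ne {u : Word} {k a x : ℕ} (hxa : a ≠ x) :
    ∀ y ∈ (u ++ List.replicate (k + 1) a).getLast?, y ≠ x := by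
  simpa [List.replicate_succ', ← List.append_assoc] using hxa

theorem D_append_replicate_singleton {u : Word} {k a x : ℕ} (hxa : a ≠ x) :
    D (u ++ List.replicate (k + 1) a ++ [x]) = leftD (u ++ List.replicate (k + 1) a) := by
  simpa using D_append_replicate (k := 0) (append_singleton_of_ne (u := u) (k := k) hxa)

theorem diffble_append_replicate_singleton {u : Word} {k a x : ℕ} (hxa : a ≠ x) :
    Diffble (u ++ List.replicate (k + 1) a ++ [x]) ↔
      Diffble (u ++ List.replicate (k + 1) a) ∧ (x = 1 ∨ x = 2) := by
  simpa using diffble_append_replicate (k := 0) (append_singleton_of_ne (u := u) (k := k) hxa)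

/-- A differentiable one-letter right extension either leaves a nonempty derivative unchanged,
or is one of two extensions of a word with empty derivative, both of them C∞-words, or the
one-letter extensions of `w` correspond to those of `D w`. -/
theorem Diffble.append_singleton_cases {w : Word} {x : ℕ} (h : Diffble (w ++ [x])) :
    Diffble w ∧
      ((D (w ++ [x]) = D w ∧ D w ≠ []) ∨
        (D w = [] ∧ ∀ y, y = 1 ∨ y = 2 → w ++ [y] ∈ Cinf) ∨
        ∃ f : ℕ → ℕ, ∀ y, y = 1 ∨ y = 2 →
          (f y = 1 ∨ f y = 2) ∧ Diffble (w ++ [y]) ∧ D (w ++ [y]) = D w ++ [f y]) := by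
  rcases eq_or_ne w [] with rfl | hw
  · exact ⟨diffble_nil, .inr (.inl ⟨D_nil, fun y hy => singleton_mem_Cinf hy⟩)⟩
  obtain ⟨u, k, a, rfl, hu⟩ := exists_eq_append_replicate hw
  have happ : u ++ List.replicate (k + 1) a ++ [a] = u ++ List.replicate (k + 1 + 1) a := by
    rw [List.replicate_succ' (n := k + 1), List.append_assoc]
  have hdiff : Diffble (u ++ List.replicate (k + 1) a) := by
    by_cases hxa : a = x
    · subst hxa
      rw [happ, diffble_append_replicate hu] at h
      exact (diffble_append_replicate hu).2 ⟨h.1, h.2.1, by omega⟩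
    · exact ((diffble_append_replicate_singleton hxa).1 h).1
  refine ⟨hdiff, ?_⟩
  obtain ⟨hud, ha, hk⟩ := (diffble_append_replicate hu).1 hdiff
  obtain rfl | rfl : k = 0 ∨ k = 1 := by omega
  · refine .inr ?_
    have hdiff' : ∀ y, y = 1 ∨ y = 2 → Diffble (u ++ List.replicate (0 + 1) a ++ [y]) := by
      intro y hy
      by_cases hya : a = y
      · subst hya
        rw [happ, diffble_append_replicate hu]
        exact ⟨hud, ha, by omega⟩
      · exact (diffble_append_replicate_singleton hya).2 ⟨hdiff, hy⟩
    have hD : D (u ++ List.replicate (0 + 1) a) = leftD u := by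
      simpa using D_append_replicate (k := 0) hu
    have hDa : D (u ++ List.replicate (0 + 1) a ++ [a]) = leftD u ++ [2] := by
      rw [happ, D_append_replicate hu]; simp
    rcases eq_or_ne u [] with rfl | hne
    · refine .inl ⟨hD, fun y hy => mem_Cinf_iff_D.2 ⟨hdiff' y hy, ?_⟩⟩
      by_cases hya : a = y
      · subst hya
        rw [hDa]
        exact singleton_mem_Cinf (.inr rfl)
      · rw [D_append_replicate_singleton hya]
        exact nil_mem_Cinf
    · refine .inr ⟨fun y => if a = y then 2 else 1, fun y hy => ⟨by grind, hdiff' y hy, ?_⟩⟩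
      by_cases hya : a = y
      · subst hya
        rw [hDa, hD]
        simp
      · rw [D_append_replicate_singleton hya, hD, leftD_append_replicate hu (.inl hne)]
        simp [hya]
  · have hxa : a ≠ x := by
      rintro rfl
      rw [happ, diffble_append_replicate hu] at h
      omega
    refine .inl ?_
    rw [D_append_replicate_singleton hxa, leftD_append_replicate hu (.inr one_ne_zero),
      D_append_replicate hu]
    simp

theorem mem_Cinf_of_append_singleton {w : Word} {x : ℕ} (h : w ++ [x] ∈ Cinf) : w ∈ Cinf := by
  by_cases hw : w = []
  · exact hw ▸ nil_mem_Cinf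
  have hlt := length_D_lt hw
  have hx := isWord_singleton.1 (isWord_append.1 (mem_Cinf_iff_D.1 h).1.1).2
  obtain ⟨h₁, h₂⟩ := mem_Cinf_iff_D.1 h
  obtain ⟨hd, ⟨heq, -⟩ | ⟨hnil, -⟩ | ⟨f, hf⟩⟩ := h₁.append_singleton_cases
  · exact mem_Cinf_iff_D.2 ⟨hd, heq ▸ h₂⟩
  · exact mem_Cinf_iff_D.2 ⟨hd, hnil ▸ nil_mem_Cinf⟩
  · exact mem_Cinf_iff_D.2 ⟨hd, mem_Cinf_of_append_singleton ((hf x hx).2.2 ▸ h₂)⟩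
termination_by w.length

/-! ### Height and root -/

theorem exists_iterate_D_eq_nil (w : Word) : ∃ k, D^[k] w = [] := by
  by_cases hw : w = []
  · exact ⟨0, hw⟩
  have hlt := length_D_lt hw
  obtain ⟨k, hk⟩ := exists_iterate_D_eq_nil (D w)
  exact ⟨k + 1, hk⟩
termination_by w.length

theorem height_pos {w : Word} (hw : w ≠ []) : 0 < height w := by
  refine Nat.pos_of_ne_zero fun h => ?_
  have hmem : D^[height w] w = [] := Nat.sInf_mem (exists_iterate_D_eq_nil w)
  rw [h] at hmem
  exact hw hmem

theorem height_eq_height_D_add_one {w : Word} (hw : w ≠ []) : height w = height (D w) + 1 :=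
  (Nat.sInf_add (p := fun k => D^[k] w = []) (height_pos hw)).symm

theorem root_eq_root_D {w : Word} (hw : D w ≠ []) : root w = root (D w) := by
  have hne : w ≠ [] := fun h => hw (h ▸ D_nil)
  obtain ⟨m, hm⟩ := Nat.exists_eq_succ_of_ne_zero (height_pos hw).ne'
  rw [root, root, height_eq_height_D_add_one hne, hm]
  rfl

theorem height_root_eq_of_D {v w : Word} (hv : D v ≠ []) (hw : D w ≠ [])
    (h : height (D v) = height (D w) ∧ root (D v) = root (D w)) :
    height v = height w ∧ root v = root w := by
  rw [height_eq_height_D_add_one fun h => hv (h ▸ D_nil),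
    height_eq_height_D_add_one (w := w) fun h => hw (h ▸ D_nil),
    root_eq_root_D hv, root_eq_root_D hw, h.1, h.2]
  exact ⟨rfl, rfl⟩

theorem iterate_D_reverse (k : ℕ) (w : Word) : D^[k] w.reverse = (D^[k] w).reverse := by
  induction k generalizing w with
  | zero => rfl
  | succ k ih => simp only [Function.iterate_succ_apply, D_reverse, ih]

theorem height_reverse (w : Word) : height w.reverse = height w := by
  simp [height, iterate_D_reverse]

theorem root_reverse (w : Word) : root w.reverse = (root w).reverse := by
  rw [root, root, height_reverse, iterate_D_reverse]

/-! ### Simple extensions -/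

/-- A forced one-letter right extension preserves height and root. -/
theorem height_root_append_singleton {w : Word} {x y : ℕ} (hy : y = 1 ∨ y = 2)
    (hwx : w ++ [x] ∈ Cinf) (hwy : w ++ [y] ∉ Cinf) :
    height (w ++ [x]) = height w ∧ root (w ++ [x]) = root w := by
  by_cases hw : w = []
  · subst hw
    exact absurd (singleton_mem_Cinf hy) hwy
  have hlt := length_D_lt hw
  have hx := isWord_singleton.1 (isWord_append.1 (mem_Cinf_iff_D.1 hwx).1.1).2
  obtain ⟨h₁, h₂⟩ := mem_Cinf_iff_D.1 hwx
  obtain ⟨-, ⟨heq, hne⟩ | ⟨-, hall⟩ | ⟨f, hf⟩⟩ := h₁.append_singleton_cases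
  · exact height_root_eq_of_D (heq ▸ hne) hne (by rw [heq]; exact ⟨rfl, rfl⟩)
  · exact absurd (hall y hy) hwy
  · have hfy : D w ++ [f y] ∉ Cinf := fun h =>
      hwy (mem_Cinf_iff_D.2 ⟨(hf y hy).2.1, (hf y hy).2.2 ▸ h⟩)
    have hne : D w ≠ [] := fun h => hfy (by rw [h]; exact singleton_mem_Cinf (hf y hy).1)
    have hDx := (hf x hx).2.2
    refine height_root_eq_of_D (by simp [hDx]) hne ?_
    rw [hDx]
    exact height_root_append_singleton (hf y hy).1 (hDx ▸ h₂) hfy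
termination_by w.length

theorem height_root_append {w s : Word} (hs : IsWord s) (h : w ++ s ∈ Cinf)
    (hforced : ∀ i < s.length, w ++ s.take i ++ [bar (s.getD i 0)] ∉ Cinf) :
    height (w ++ s) = height w ∧ root (w ++ s) = root w := by
  induction s using List.reverseRecOn with
  | nil => simp
  | append_singleton s x ih =>
    rw [← List.append_assoc] at h ⊢
    obtain ⟨hs, hx⟩ := isWord_append.1 hs
    have hlast := hforced s.length (by simp)
    obtain ⟨h₁, h₂⟩ := height_root_append_singleton (isWord_bar (isWord_singleton.1 hx)) h
      (by simpa using hlast)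
    obtain ⟨h₃, h₄⟩ := ih hs (mem_Cinf_of_append_singleton h) fun i hi => by
      have := hforced i (by simp; omega)
      rwa [List.take_append_of_le_length hi.le, List.getD_append _ _ _ _ hi] at this
    exact ⟨h₁.trans h₃, h₂.trans h₄⟩

theorem RightSimpleExt.height_root_eq {w v : Word} (h : RightSimpleExt w v) :
    height v = height w ∧ root v = root w := by
  obtain ⟨hv, s, hs, rfl, hforced⟩ := h
  exact height_root_append hs hv hforced

theorem LeftSimpleExt.height_root_eq {w v : Word} (h : LeftSimpleExt w v) :
    height v = height w ∧ root v = root w := by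
  simpa [height_reverse, root_reverse] using RightSimpleExt.height_root_eq h

theorem SimpleExt.height_root_eq {w v : Word} (h : SimpleExt w v) :
    height v = height w ∧ root v = root w := by
  obtain ⟨u, hu, hv⟩ := h
  exact ⟨hv.height_root_eq.1.trans hu.height_root_eq.1,
    hv.height_root_eq.2.trans hu.height_root_eq.2⟩

end CinftyWords

open CinftyWords in
/-- Every simple extension of a C∞-word `w` has the same height and the same root as
`w`; in particular, so does the maximal extension of `w`. -/
theorem simple_extension_same_height_root (w : Word) (hw : w ∈ Cinf) :
    (∀ w', SimpleExt w w' → height w' = height w ∧ root w' = root w) ∧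
    (∀ m, IsMaximalExtension w m → height m = height w ∧ root m = root w) := by
  exact ⟨fun _ h => h.height_root_eq, fun _ h => h.1.height_root_eq⟩
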